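/- (Albert's theorem.) Let k be a number field, p a prime, and K/k a cyclic extension of degree p^N (N ≥ 1). Suppose k contains the group μ_{p^ε} of p^ε-th roots of unity. Then μ_{p^ε} is contained in the image of the norm map N_{K/k} : K^× → k^× if and only if there exists a cyclic extension L/K of degree p^ε such that L/k is cyclic (equivalently, there exists a field L ⊇ K with L/k cyclic of degree p^{N+ε}). -/

import Mathlib

universe u v

/-- A cyclic extension `L` of `k` of degree `d`, containing `K` (as fields over `k`). -/
structure CyclicExtContaining (k : Type u) (K : Type v) [Field k] [Field K] [Algebra k K]
    (d : ℕ) where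
  /-- the top field -/
  L : Type (max u v)
  [fieldL : Field L]
  [algkL : Algebra k L]
  [algKL : Algebra K L]
  [tower : IsScalarTower k K L]
  [fd : FiniteDimensional k L]
  [gal : IsGalois k L]
  cyc : IsCyclic (L ≃ₐ[k] L)
  deg : Module.finrank k L = d

section CyclicNorm

open Finset IntermediateField

/-- The norm of a cyclic extension is the product over the powers of a generator. -/
theorem algebraMap_norm_eq_prod_range {k K : Type*} [Field k] [Field K] [Algebra k K]
    [FiniteDimensional k K] [IsGalois k K] {g : K ≃ₐ[k] K}
    (hg : ∀ x, x ∈ Subgroup.zpowers g) (x : K) :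
    algebraMap k K (Algebra.norm k x) = ∏ i ∈ range (Module.finrank k K), (g ^ i) x := by
  classical
  have hord : orderOf g = Module.finrank k K :=
    (orderOf_eq_card_of_forall_mem_zpowers hg).trans (IsGalois.card_aut_eq_finrank k K)
  rw [Algebra.norm_eq_prod_automorphisms, ← hord, ← IsCyclic.image_range_orderOf hg, prod_image]
  intro i hi j hj hij
  exact pow_injOn_Iio_orderOf (by simpa using hi) (by simpa using hj) hij

/-- Hilbert's Theorem 90 for an automorphism of finite order. -/
theorem exists_mul_apply_eq_self_of_prod_eq_one {k K : Type*} [Field k] [Field K] [Algebra k K]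
    (g : K ≃ₐ[k] K) {n : ℕ} (hg : orderOf g = n) (hn : 0 < n) {x : K}
    (hx : ∏ i ∈ range n, (g ^ i) x = 1) : ∃ y : K, y ≠ 0 ∧ x * g y = y := by
  let c : ℕ → K := fun i => ∏ j ∈ range i, (g ^ j) x
  let f : Fin n → K →* K := fun i => ((g ^ (i : ℕ) : K ≃ₐ[k] K) : K →* K)
  have hf : Function.Injective f := by
    intro i j hij
    apply Fin.ext
    refine pow_injOn_Iio_orderOf (x := g) (by simp [hg]) (by simp [hg]) ?_
    ext z
    exact DFunLike.congr_fun hij z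
  have hli := (linearIndependent_monoidHom K K).comp f hf
  obtain ⟨z, hz⟩ : ∃ z, ∑ i ∈ range n, c i * (g ^ i) z ≠ 0 := by
    by_contra! H
    have h0 := Fintype.linearIndependent_iff.1 hli (fun i => c i) (by
      ext z
      have := H z
      rw [← Fin.sum_univ_eq_sum_range (fun i => c i * (g ^ i) z)] at this
      simpa [f] using this) ⟨0, hn⟩
    simp [c] at h0
  refine ⟨_, hz, ?_⟩
  have hstep : ∀ i, x * g (c i * (g ^ i) z) = c (i + 1) * (g ^ (i + 1)) z := by
    intro i
    simp only [c, map_mul, map_prod, prod_range_succ', pow_succ' g, AlgEquiv.mul_apply, pow_zero,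
      AlgEquiv.one_apply]
    ring
  rw [map_sum, mul_sum, sum_congr rfl fun i _ => hstep i]
  have h1 := sum_range_succ (fun i => c i * (g ^ i) z) n
  rw [sum_range_succ'] at h1
  have h2 : c n * (g ^ n) z = c 0 * (g ^ 0) z := by
    rw [← hg, pow_orderOf_eq_one, hg]
    simp only [c, hx, AlgEquiv.one_apply, prod_range_zero, pow_zero]
  rw [h2] at h1
  exact add_right_cancel h1

variable {k K L : Type*} [Field k] [Field K] [Field L] [Algebra k K] [Algebra k L] [Algebra K L]

theorem pow_apply_algebraMap {s : L ≃ₐ[k] L} {g : K ≃ₐ[k] K}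
    (hs : ∀ x, s (algebraMap K L x) = algebraMap K L (g x)) (n : ℕ) (x : K) :
    (s ^ n) (algebraMap K L x) = algebraMap K L ((g ^ n) x) := by
  induction n with
  | zero => simp
  | succ n ih => rw [pow_succ', pow_succ', AlgEquiv.mul_apply, ih, hs, AlgEquiv.mul_apply]

theorem pow_apply_of_apply_eq_mul {s : L ≃ₐ[k] L} {g : K ≃ₐ[k] K}
    (hs : ∀ x, s (algebraMap K L x) = algebraMap K L (g x)) {b : L} {β : K}
    (hb : s b = algebraMap K L β * b) (n : ℕ) :
    (s ^ n) b = algebraMap K L (∏ i ∈ range n, (g ^ i) β) * b := by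
  induction n with
  | zero => simp
  | succ n ih =>
    rw [pow_succ', AlgEquiv.mul_apply, ih, map_mul, hs, hb, prod_range_succ']
    simp only [map_mul, map_prod, pow_succ' g, AlgEquiv.mul_apply, pow_zero, AlgEquiv.one_apply]
    ring

variable [IsScalarTower k K L]

theorem pow_finrank_apply_of_apply_eq_mul [FiniteDimensional k K] [IsGalois k K]
    {s : L ≃ₐ[k] L} {g : K ≃ₐ[k] K} (hg : ∀ x, x ∈ Subgroup.zpowers g)
    (hs : ∀ x, s (algebraMap K L x) = algebraMap K L (g x)) {b : L} {β : K}
    (hb : s b = algebraMap K L β * b) :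
    (s ^ Module.finrank k K) b = algebraMap k L (Algebra.norm k β) * b := by
  rw [pow_apply_of_apply_eq_mul hs hb, ← algebraMap_norm_eq_prod_range hg,
    ← IsScalarTower.algebraMap_apply]

/-- If `L ⊇ K ⊇ k` with `L/k` cyclic, then the roots of unity in `k` of order dividing `[L : K]`
are norms from `K`. -/
theorem exists_norm_eq_of_isCyclic [FiniteDimensional k L] [IsGalois k L] [IsGalois k K]
    (hcyc : IsCyclic (L ≃ₐ[k] L)) {n q : ℕ} (hn : Module.finrank k K = n)
    (hnq : Module.finrank k L = n * q) {x : k} (hx : x ^ q = 1) :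
    ∃ y : K, Algebra.norm k y = x := by
  have : FiniteDimensional k K := FiniteDimensional.left k K L
  have : FiniteDimensional K L := FiniteDimensional.right k K L
  have : IsGalois K L := IsGalois.tower_top_of_isGalois k K L
  have hpos : 0 < n * q := hnq ▸ Module.finrank_pos
  have hn0 : 0 < n := pos_of_mul_pos_left hpos (Nat.zero_le _)
  have hq0 : 0 < q := pos_of_mul_pos_right hpos (Nat.zero_le _)
  obtain ⟨s, hsgen⟩ := hcyc.exists_generator
  have hsord : orderOf s = n * q :=
    (orderOf_eq_card_of_forall_mem_zpowers hsgen).trans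
      ((IsGalois.card_aut_eq_finrank k L).trans hnq)
  let g : K ≃ₐ[k] K := AlgEquiv.restrictNormalHom K s
  have hs : ∀ x, s (algebraMap K L x) = algebraMap K L (g x) := fun x =>
    (AlgEquiv.restrictNormal_commutes s K x).symm
  have hggen : ∀ y, y ∈ Subgroup.zpowers g := by
    intro y
    obtain ⟨t, rfl⟩ := AlgEquiv.restrictNormalHom_surjective (F := k) (K₁ := K) L y
    obtain ⟨i, rfl⟩ := hsgen t
    exact ⟨i, by simp [g]⟩
  have hgord : orderOf g = n :=
    (orderOf_eq_card_of_forall_mem_zpowers hggen).trans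
      ((IsGalois.card_aut_eq_finrank k K).trans hn)
  have hx0 : x ≠ 0 := by
    rintro rfl
    simp [zero_pow hq0.ne'] at hx
  obtain ⟨b, hb0, hb⟩ := exists_mul_apply_eq_self_of_prod_eq_one (s ^ n) (n := q)
    (x := algebraMap k L x⁻¹)
    (by rw [orderOf_pow_of_dvd hn0.ne' (hsord ▸ dvd_mul_right n q), hsord,
          Nat.mul_div_cancel_left _ hn0]) hq0
    (by simp only [AlgEquiv.commutes, prod_const, card_range, ← map_pow, inv_pow, hx, inv_one,
          map_one])
  have hτ : (s ^ n) b = algebraMap k L x * b := by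
    have hx0' : algebraMap k L x ≠ 0 := by simpa using hx0
    rw [map_inv₀] at hb
    field_simp at hb
    exact hb
  obtain ⟨β, hβ⟩ : s b / b ∈ Set.range (algebraMap K L) := by
    rw [IsGalois.mem_range_algebraMap_iff_fixed]
    intro h
    obtain ⟨m, hm⟩ := (mem_powers_iff_mem_zpowers).2 (hsgen (h.restrictScalars k))
    have hm : s ^ m = h.restrictScalars k := hm
    have hgm : g ^ m = 1 := by
      ext y
      apply (algebraMap K L).injective
      rw [← pow_apply_algebraMap hs, hm]
      simp
    obtain ⟨c, rfl⟩ := hgord ▸ orderOf_dvd_of_pow_eq_one hgm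
    have hfix : (s ^ n) (s b / b) = s b / b := by
      rw [map_div₀, ← AlgEquiv.mul_apply, (Commute.pow_self s n).eq, AlgEquiv.mul_apply, hτ,
        map_mul, AlgEquiv.commutes, mul_div_mul_left]
      simpa using hx0
    have hfixc : ∀ c : ℕ, ((s ^ n) ^ c) (s b / b) = s b / b := by
      intro c
      induction c with
      | zero => simp
      | succ c ih => rw [pow_succ, AlgEquiv.mul_apply, hfix, ih]
    have := hfixc c
    rwa [← pow_mul, hm] at this
  refine ⟨β, ?_⟩
  have h1 := pow_finrank_apply_of_apply_eq_mul hggen hs (b := b) (β := β)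
    (by rw [hβ, div_mul_cancel₀ _ hb0])
  rw [hn, hτ] at h1
  exact (algebraMap k L).injective (mul_right_cancel₀ hb0 h1.symm)

/-- If a generator of `Gal(K/k)` extends to an automorphism of `L` which multiplies some nonzero
element by some `β ∈ K` whose norm is a primitive `q`-th root of unity, and `[L : K] ≤ q`, then
`L/k` is cyclic of degree `[K : k] q`. -/
theorem isCyclic_of_apply_eq_mul [FiniteDimensional k K] [FiniteDimensional k L] [IsGalois k K]
    {s : L ≃ₐ[k] L} {g : K ≃ₐ[k] K} (hg : ∀ x, x ∈ Subgroup.zpowers g)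
    (hs : ∀ x, s (algebraMap K L x) = algebraMap K L (g x)) {b : L} (hb0 : b ≠ 0) {β : K}
    (hb : s b = algebraMap K L β * b) {q : ℕ} (hβ : IsPrimitiveRoot (Algebra.norm k β) q)
    (hq : Module.finrank K L ≤ q) :
    IsGalois k L ∧ IsCyclic (L ≃ₐ[k] L) ∧ Module.finrank k L = Module.finrank k K * q := by
  have hgord : orderOf g = Module.finrank k K :=
    (orderOf_eq_card_of_forall_mem_zpowers hg).trans (IsGalois.card_aut_eq_finrank k K)
  have hdvd : Module.finrank k K * q ∣ orderOf s := by
    have h1 : g ^ orderOf s = 1 := by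
      ext y
      apply (algebraMap K L).injective
      rw [← pow_apply_algebraMap hs, pow_orderOf_eq_one]
      simp
    obtain ⟨c, hc⟩ := hgord ▸ orderOf_dvd_of_pow_eq_one h1
    rw [hc]
    refine Nat.mul_dvd_mul_left _ (hβ.dvd_of_pow_eq_one c ?_)
    have hpow : ∀ c : ℕ, ((s ^ Module.finrank k K) ^ c) b
        = algebraMap k L (Algebra.norm k β ^ c) * b := by
      intro c
      induction c with
      | zero => simp
      | succ c ih =>
        rw [pow_succ, AlgEquiv.mul_apply, pow_finrank_apply_of_apply_eq_mul hg hs hb, map_mul, ih,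
          AlgEquiv.commutes, pow_succ, map_mul]
        ring
    have h2 := hpow c
    rw [← pow_mul, ← hc, pow_orderOf_eq_one, AlgEquiv.one_apply] at h2
    apply (algebraMap k L).injective
    rw [map_one]
    exact mul_right_cancel₀ hb0 (by rw [← h2, one_mul])
  have h1 : Module.finrank k K * q ≤ orderOf s := Nat.le_of_dvd (orderOf_pos s) hdvd
  have h2 : orderOf s ≤ Nat.card (L ≃ₐ[k] L) := orderOf_le_card
  have h3 : Nat.card (L ≃ₐ[k] L) ≤ Module.finrank k L := by
    rw [Nat.card_eq_fintype_card]
    exact AlgEquiv.card_le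
  have h4 : Module.finrank k L ≤ Module.finrank k K * q := by
    have : FiniteDimensional K L := FiniteDimensional.right k K L
    rw [← Module.finrank_mul_finrank k K L]
    exact Nat.mul_le_mul_left _ hq
  exact ⟨IsGalois.of_card_aut_eq_finrank k L (by lia),
    isCyclic_of_orderOf_eq_card s (by lia), by lia⟩

/-- If a primitive `q`-th root of unity `ζ ∈ k` is a norm from the cyclic extension `K/k`, and `q`
and `1 + j [K : k]` are always coprime, then `K` embeds in a cyclic extension of `k` of degree
`[K : k] q`. -/
theorem exists_intermediateField_isCyclic [FiniteDimensional k K] [IsGalois k K]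
    [IsAlgClosed L] [Algebra.IsAlgebraic k L] (hcyc : IsCyclic (K ≃ₐ[k] K)) {q : ℕ} (hq : 0 < q)
    (hcop : ∀ j, (1 + j * Module.finrank k K).Coprime q) {ζ : k} (hζ : IsPrimitiveRoot ζ q)
    {β : K} (hβ : Algebra.norm k β = ζ) :
    ∃ E : IntermediateField K L, FiniteDimensional k E ∧ IsGalois k E ∧ IsCyclic (E ≃ₐ[k] E) ∧
      Module.finrank k E = Module.finrank k K * q := by
  have : NeZero q := ⟨hq.ne'⟩
  have : Normal k L := normal_iff.2 fun x =>
    ⟨Algebra.IsIntegral.isIntegral x, IsAlgClosed.splits _⟩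
  obtain ⟨g, hg⟩ := hcyc.exists_generator
  have hβ0 : β ≠ 0 := by
    rintro rfl
    exact hζ.ne_zero hq.ne' (by simpa using hβ.symm)
  obtain ⟨a, ha0, ha⟩ := exists_mul_apply_eq_self_of_prod_eq_one g
    ((orderOf_eq_card_of_forall_mem_zpowers hg).trans (IsGalois.card_aut_eq_finrank k K))
    Module.finrank_pos (x := (β ^ q)⁻¹)
    (by rw [← algebraMap_norm_eq_prod_range hg, Algebra.norm_inv, map_pow, hβ, hζ.pow_eq_one,
          inv_one, map_one])
  have hga : g a = β ^ q * a := by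
    field_simp at ha
    linear_combination ha
  obtain ⟨b, hb⟩ := IsAlgClosed.exists_pow_nat_eq (algebraMap K L a) hq
  have hb0 : b ≠ 0 := by
    rintro rfl
    rw [zero_pow hq.ne', eq_comm, map_eq_zero] at hb
    exact ha0 hb
  let t : L ≃ₐ[k] L := g.liftNormal L
  have ht : ∀ x, t (algebraMap K L x) = algebraMap K L (g x) := g.liftNormal_commutes L
  have hβL : algebraMap K L β ≠ 0 := by simpa using hβ0
  obtain ⟨j, -, hj⟩ := (hζ.map_of_injective (algebraMap k L).injective).eq_pow_of_pow_eq_one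
    (ξ := t b / (algebraMap K L β * b)) (by
      rw [div_pow, ← map_pow, mul_pow, hb, ht, hga, map_mul, map_pow, div_self]
      simpa [hβ0] using ha0)
  have htb : t b = algebraMap K L (β * algebraMap k K (ζ ^ j)) * b := by
    rw [eq_div_iff (by simp [hβ0, hb0])] at hj
    rw [← hj, map_mul, ← IsScalarTower.algebraMap_apply, map_pow]
    ring
  have hnorm : IsPrimitiveRoot (Algebra.norm k (β * algebraMap k K (ζ ^ j))) q := by
    rw [map_mul, hβ, Algebra.norm_algebraMap, ← pow_mul, ← pow_succ', add_comm]
    exact hζ.pow_of_coprime _ (hcop j)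
  have hbint : IsIntegral K b := .of_pow hq (hb ▸ isIntegral_algebraMap)
  have : FiniteDimensional K K⟮b⟯ := adjoin.finiteDimensional hbint
  have : FiniteDimensional k K⟮b⟯ := FiniteDimensional.trans k K K⟮b⟯
  have htE : ∀ x ∈ K⟮b⟯, t x ∈ K⟮b⟯ := by
    intro x hx
    induction hx using adjoin_induction with
    | mem x hx =>
      rw [Set.mem_singleton_iff.1 hx, htb]
      exact mul_mem (K⟮b⟯.algebraMap_mem _) (mem_adjoin_simple_self K b)
    | algebraMap x => rw [ht]; exact K⟮b⟯.algebraMap_mem _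
    | add x y _ _ hx hy => rw [map_add]; exact add_mem hx hy
    | inv x _ hx => rw [map_inv₀]; exact inv_mem hx
    | mul x y _ _ hx hy => rw [map_mul]; exact mul_mem hx hy
  let f : K⟮b⟯ →ₐ[k] K⟮b⟯ :=
    { toFun := fun x => ⟨t x, htE x x.2⟩
      map_one' := Subtype.ext (map_one t)
      map_mul' := fun x y => Subtype.ext (map_mul t (x : L) y)
      map_zero' := Subtype.ext (map_zero t)
      map_add' := fun x y => Subtype.ext (map_add t (x : L) y)
      commutes' := fun x => Subtype.ext (t.commutes x) }
  let s : K⟮b⟯ ≃ₐ[k] K⟮b⟯ := .ofBijective f (Algebra.IsAlgebraic.algHom_bijective f)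
  refine ⟨K⟮b⟯, inferInstance, isCyclic_of_apply_eq_mul (s := s) hg
    (fun x => Subtype.ext (ht x)) (b := AdjoinSimple.gen K b)
    (fun h => hb0 (congrArg Subtype.val h)) (Subtype.ext htb) hnorm ?_⟩
  rw [adjoin.finrank hbint, ← Polynomial.natDegree_X_pow_sub_C (n := q) (r := a)]
  exact Polynomial.natDegree_le_of_dvd (minpoly.dvd K b (by simp [hb]))
    (Polynomial.X_pow_sub_C_ne_zero hq a)

end CyclicNorm

/-- **Albert's theorem.** Let `k` be a number field, `p` a prime and `K/k` a
cyclic extension of degree `p ^ N` (`N ≥ 1`).  Suppose `k` contains the group `μ_{p^ε}` of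
`p^ε`-th roots of unity.  Then `μ_{p^ε}` is contained in the image of the norm
`N_{K/k} : K^× → k^×` if and only if there exists a field `L ⊇ K` such that `L/k` is cyclic
of degree `p^{N+ε}`. -/
theorem stmt_4 (p N ε : ℕ) (hp : p.Prime) (hN : 1 ≤ N)
    (k : Type u) (K : Type v) [Field k] [NumberField k] [Field K] [NumberField K]
    [Algebra k K] [IsGalois k K] (hcyc : IsCyclic (K ≃ₐ[k] K))
    (hdeg : Module.finrank k K = p ^ N)
    (hμ : ∃ ζ : k, IsPrimitiveRoot ζ (p ^ ε)) :
    (∀ x : k, x ^ (p ^ ε) = 1 → ∃ y : K, Algebra.norm k y = x) ↔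
      Nonempty (CyclicExtContaining k K (p ^ (N + ε))) := by
  have : FiniteDimensional k K := FiniteDimensional.of_finrank_pos
    (hdeg ▸ pow_pos hp.pos N)
  constructor
  · intro h
    obtain ⟨ζ, hζ⟩ := hμ
    obtain ⟨β, hβ⟩ := h ζ hζ.pow_eq_one
    have : Algebra.IsAlgebraic k (AlgebraicClosure K) := Algebra.IsAlgebraic.trans k K _
    obtain ⟨E, _, _, hE, hEdeg⟩ := exists_intermediateField_isCyclic (L := AlgebraicClosure K)
      hcyc (pow_pos hp.pos ε) (fun j => by
        refine Nat.Coprime.pow_right ε (Nat.coprime_comm.1 ((hp.coprime_iff_not_dvd).2 ?_))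
        rw [hdeg, ← Nat.dvd_add_iff_left ((dvd_pow_self p (by lia)).mul_left j)]
        exact hp.one_lt.ne' ∘ Nat.dvd_one.1) hζ hβ
    let e : E ≃ₐ[k] ULift.{u} E := ULift.algEquiv.symm
    exact ⟨{ L := ULift.{u} E
             fd := FiniteDimensional.of_injective e.symm.toLinearMap e.symm.injective
             gal := .of_algEquiv e
             cyc := isCyclic_of_surjective e.autCongr e.autCongr.surjective
             deg := by rw [← e.toLinearEquiv.finrank_eq, hEdeg, hdeg, pow_add] }⟩
  · rintro ⟨M⟩ x hx
    let := M.fieldL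
    let := M.algkL
    let := M.algKL
    have := M.tower
    have := M.fd
    have := M.gal
    exact exists_norm_eq_of_isCyclic (L := M.L) M.cyc hdeg (M.deg.trans (pow_add p N ε)) hx
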